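/- arXiv:math/0508182 — 4 statements merged into one kernel-verified Lean document; each statement's English description precedes it below -/
import Mathlib

section
/- Let R be a commutative noetherian ring and Q(R) its total ring of fractions, and let I and J be invertible fractional ideals of R. Then I = J if and only if for every nonzerodivisor r of R and every prime ideal 𝔭 of R that is an associated prime of the R-module R/rR, the localizations of I and J at 𝔭 coincide (i.e. the R_𝔭-submodules I·R_𝔭 and J·R_𝔭 of the localization of Q(R) at 𝔭 are equal). -/
open nonZeroDivisors in
/-- A fractional ideal contained in an invertible one locally at all primes associated to
quotients by a nonzerodivisor is contained in it globally. -/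
theorem FractionalIdeal.le_of_localized_le_of_isUnit {R : Type*} [CommRing R] [IsNoetherianRing R]
    {I J : FractionalIdeal R⁰ (FractionRing R)} (hJ : IsUnit J)
    (h : ∀ r ∈ R⁰, ∀ (𝔭 : Ideal R) (h𝔭 : 𝔭 ∈ associatedPrimes R (R ⧸ Ideal.span {r})),
      haveI : 𝔭.IsPrime := h𝔭.isPrime
      (I : Submodule R (FractionRing R)).localized 𝔭.primeCompl ≤
        (J : Submodule R (FractionRing R)).localized 𝔭.primeCompl) :
    I ≤ J := by
  obtain ⟨L, hJL⟩ := hJ.exists_right_inv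
  suffices hIL : I * L ≤ 1 by
    calc I = I * L * J := by rw [mul_assoc, mul_comm L, hJL, mul_one]
      _ ≤ 1 * J := mul_le_mul_left hIL J
      _ = J := one_mul J
  rw [FractionalIdeal.mul_le]
  intro x hx y hy
  obtain ⟨a, r, har⟩ := IsLocalization.exists_mk'_eq R⁰ (x * y)
  by_contra hxy
  have ha : (Ideal.Quotient.mk (Ideal.span {(r : R)}) a) ≠ 0 := by
    intro ha
    obtain ⟨b, rfl⟩ := Ideal.mem_span_singleton.mp (Ideal.Quotient.eq_zero_iff_mem.mp ha)
    refine hxy ((FractionalIdeal.mem_one_iff _).mpr ⟨b, ?_⟩)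
    rw [← har, IsLocalization.mk'_mul_cancel_left]
  obtain ⟨𝔭, h𝔭, hle⟩ := exists_le_isAssociatedPrime_of_isNoetherianRing R _ ha
  have := h𝔭.isPrime
  have hxI : LocalizedModule.mk x 1 ∈
      (I : Submodule R (FractionRing R)).localized 𝔭.primeCompl :=
    ⟨x, hx, 1, (IsLocalizedModule.mk_eq_mk' 1 x).symm⟩
  obtain ⟨m, hm, s, hms⟩ := h r r.2 𝔭 h𝔭 hxI
  rw [← IsLocalizedModule.mk_eq_mk', LocalizedModule.mk_eq] at hms
  obtain ⟨u, hu⟩ := hms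
  have hsx : ((u * s : 𝔭.primeCompl) : R) • x ∈ J := by
    have hmJ := (J : Submodule R (FractionRing R)).smul_mem (u : R) hm
    simp only [one_smul, Submonoid.smul_def] at hu
    rw [hu] at hmJ
    simpa [mul_smul] using hmJ
  have hsxy := FractionalIdeal.mul_mem_mul hsx hy
  rw [hJL, FractionalIdeal.mem_one_iff] at hsxy
  obtain ⟨b, hb⟩ := hsxy
  refine (u * s).2 (hle ?_)
  have hsa : ((u * s : 𝔭.primeCompl) : R) * a = r * b := by
    apply IsFractionRing.injective R (FractionRing R)
    rw [map_mul, map_mul, hb, ← IsLocalization.mk'_spec' (FractionRing R) a r, har,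
      Algebra.smul_def]
    ring
  rw [Submodule.mem_colon_singleton, Submodule.mem_bot, ← Ideal.Quotient.mk_eq_mk,
    ← Submodule.Quotient.mk_smul]
  exact (Submodule.Quotient.mk_eq_zero _).mpr (Ideal.mem_span_singleton.mpr ⟨b, hsa⟩)

/-- Over a commutative noetherian ring `R`, two invertible fractional
ideals `I` and `J` of `R` are equal if and only if their localizations agree at every
prime `𝔭` associated to `R ⧸ rR` for some nonzerodivisor `r`. -/
theorem stmt_0 (R : Type*) [CommRing R] [IsNoetherianRing R]
    (I J : FractionalIdeal (nonZeroDivisors R) (FractionRing R))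
    (hI : IsUnit I) (hJ : IsUnit J) :
    I = J ↔
      ∀ r ∈ nonZeroDivisors R,
        ∀ (𝔭 : Ideal R) (h𝔭 : 𝔭 ∈ associatedPrimes R (R ⧸ Ideal.span {r})),
          haveI : 𝔭.IsPrime := h𝔭.isPrime
          (I : Submodule R (FractionRing R)).localized 𝔭.primeCompl =
            (J : Submodule R (FractionRing R)).localized 𝔭.primeCompl := by
  refine ⟨fun h _ _ _ _ ↦ by rw [h], fun h ↦ le_antisymm ?_ ?_⟩
  · exact FractionalIdeal.le_of_localized_le_of_isUnit hJ fun r hr 𝔭 h𝔭 ↦ (h r hr 𝔭 h𝔭).le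
  · exact FractionalIdeal.le_of_localized_le_of_isUnit hI fun r hr 𝔭 h𝔭 ↦ (h r hr 𝔭 h𝔭).ge
end

section
/- Let R be a commutative ring with only finitely many maximal ideals (a semilocal ring) and let Q(R) be its total ring of fractions. Then every invertible fractional ideal of R is principal: for every invertible fractional ideal I there exists a unit x of Q(R) such that I = R·x. Consequently the group of invertible fractional ideals of R is isomorphic to Q(R)ˣ/Rˣ. -/
open FractionalIdeal nonZeroDivisors in
/-- The homomorphism sending a unit of the total ring of fractions to the invertible fractional
ideal it generates. -/
noncomputable def FractionalIdeal.unitsSpanSingleton (R K : Type*) [CommRing R] [CommRing K]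
    [Algebra R K] [IsFractionRing R K] : Kˣ →* (FractionalIdeal R⁰ K)ˣ :=
  Units.map
    { toFun := spanSingleton R⁰
      map_one' := spanSingleton_one
      map_mul' := fun x y => (spanSingleton_mul_spanSingleton x y).symm }

open FractionalIdeal nonZeroDivisors in
theorem FractionalIdeal.unitsSpanSingleton_eq_iff {R K : Type*} [CommRing R] [CommRing K]
    [Algebra R K] [IsFractionRing R K] {x : Kˣ} {I : (FractionalIdeal R⁰ K)ˣ} :
    unitsSpanSingleton R K x = I ↔ spanSingleton R⁰ (x : K) = I :=
  Units.ext_iff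

open FractionalIdeal nonZeroDivisors in
/-- If a principal fractional ideal is invertible, then its generator is a unit. -/
theorem FractionalIdeal.isUnit_of_isUnit_spanSingleton {R K : Type*} [CommRing R] [CommRing K]
    [Algebra R K] [IsFractionRing R K] {x : K} (h : IsUnit (spanSingleton R⁰ x)) : IsUnit x := by
  obtain ⟨J, hJ⟩ := h.exists_right_inv
  have h1 : (1 : K) ∈ spanSingleton R⁰ x * J := hJ ▸ one_mem_one R⁰
  obtain ⟨y, -, hy⟩ := mem_singleton_mul.1 h1
  exact IsUnit.of_mul_eq_one y hy.symm

open FractionalIdeal nonZeroDivisors in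
/-- A unit of the total ring of fractions generates the unit ideal if and only if it comes from a unit
of the base ring. -/
theorem FractionalIdeal.unitsSpanSingleton_ker (R K : Type*) [CommRing R] [CommRing K] [Algebra R K]
    [IsFractionRing R K] :
    (unitsSpanSingleton R K).ker = (Units.map (algebraMap R K).toMonoidHom).range := by
  have exists_algebraMap_eq {x : Kˣ} (hx : x ∈ (unitsSpanSingleton R K).ker) :
      ∃ r : R, algebraMap R K r = x := by
    rw [MonoidHom.mem_ker, unitsSpanSingleton_eq_iff, Units.val_one] at hx
    exact (mem_one_iff R⁰).1 (hx ▸ mem_spanSingleton_self R⁰ (x : K))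
  ext x
  constructor
  · intro hx
    obtain ⟨r, hr⟩ := exists_algebraMap_eq hx
    obtain ⟨s, hs⟩ := exists_algebraMap_eq (inv_mem hx)
    have hrs : r * s = 1 := IsFractionRing.injective R K (by simp [hr, hs])
    exact ⟨Units.mkOfMulEqOne r s hrs, Units.ext hr⟩
  · rintro ⟨u, rfl⟩
    rw [MonoidHom.mem_ker, unitsSpanSingleton_eq_iff, Units.val_one, ← spanSingleton_one]
    refine le_antisymm ?_ ?_ <;> rw [spanSingleton_le_iff_mem, mem_spanSingleton]
    · exact ⟨u, by simp [Algebra.smul_def]⟩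
    · exact ⟨(u⁻¹ : Rˣ), by simp [Algebra.smul_def, ← map_mul]⟩

open FractionalIdeal nonZeroDivisors in
/-- Over a semilocal ring, every invertible fractional ideal is generated by a unit of the total
ring of fractions. -/
theorem FractionalIdeal.exists_eq_spanSingleton_of_finite_maximals {R K : Type*} [CommRing R]
    [CommRing K] [Algebra R K] [IsFractionRing R K] (hf : {I : Ideal R | I.IsMaximal}.Finite)
    {I : FractionalIdeal R⁰ K} (hI : IsUnit I) : ∃ x : Kˣ, I = spanSingleton R⁰ (x : K) := by
  obtain ⟨J, hJ⟩ := hI.exists_right_inv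
  have hprin := isPrincipal.of_finite_maximals_of_inv le_rfl hf I J hJ
  obtain ⟨x, rfl⟩ := (isPrincipal_iff I).1 hprin
  exact ⟨(isUnit_of_isUnit_spanSingleton hI).unit, rfl⟩

/-- Over a semilocal commutative ring `R` (finitely many maximal ideals),
every invertible fractional ideal is principal, generated by a unit of the total ring of
fractions `Q(R)`; consequently the group of invertible fractional ideals of `R` is
isomorphic to `Q(R)ˣ/Rˣ`. -/
theorem stmt_3 (R : Type*) [CommRing R]
    (hsemilocal : {I : Ideal R | I.IsMaximal}.Finite) :
    (∀ I : FractionalIdeal (nonZeroDivisors R) (FractionRing R), IsUnit I →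
      ∃ x : (FractionRing R)ˣ,
        I = FractionalIdeal.spanSingleton (nonZeroDivisors R) (x : FractionRing R)) ∧
    Nonempty ((FractionalIdeal (nonZeroDivisors R) (FractionRing R))ˣ ≃*
      (FractionRing R)ˣ ⧸
        (Units.map (algebraMap R (FractionRing R)).toMonoidHom).range) := by
  have hprin (I : FractionalIdeal (nonZeroDivisors R) (FractionRing R)) (hI : IsUnit I) :=
    FractionalIdeal.exists_eq_spanSingleton_of_finite_maximals hsemilocal hI
  have hsurj : Function.Surjective (FractionalIdeal.unitsSpanSingleton R (FractionRing R)) := fun I =>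
    (hprin I I.isUnit).imp fun _ hx =>
      FractionalIdeal.unitsSpanSingleton_eq_iff.2 hx.symm
  exact ⟨hprin, ⟨(QuotientGroup.quotientKerEquivOfSurjective _ hsurj).symm.trans
    (QuotientGroup.quotientMulEquivOfEq (FractionalIdeal.unitsSpanSingleton_ker R (FractionRing R)))⟩⟩
end

section
/- Let p be a prime, let R be a commutative local ring whose residue field has characteristic p, and let Δ be a finite p-group. Then the group algebra R[Δ] (the monoid algebra of Δ over R) is a local ring. -/
/-- A `p`-group acting linearly on a nontrivial `𝔽_p`-vector space fixes a nonzero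
vector. -/
theorem IsPGroup.exists_ne_zero_forall_smul_eq {p : ℕ} [Fact p.Prime] {G V : Type*} [Group G]
    [Finite G] (hG : IsPGroup p G) [AddCommGroup V] [Module (ZMod p) V]
    [DistribMulAction G V] [Nontrivial V] : ∃ v : V, v ≠ 0 ∧ ∀ g : G, g • v = v := by
  obtain ⟨s, hs⟩ := exists_ne (0 : V)
  let W : Submodule (ZMod p) V := Submodule.span (ZMod p) (Set.range fun g : G ↦ g • s)
  have hW (g : G) (w : V) (hw : w ∈ W) : g • w ∈ W := by
    induction hw using Submodule.span_induction with
    | mem x hx =>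
      obtain ⟨h, rfl⟩ := hx
      exact Submodule.subset_span ⟨g * h, mul_smul g h s⟩
    | zero => simp
    | add x y _ _ hx hy => rw [smul_add]; exact W.add_mem hx hy
    | smul c x _ hx =>
      rw [show g • c • x = c • g • x from ZMod.map_smul (DistribSMul.toAddMonoidHom V g) c x]
      exact W.smul_mem c hx
  have hsW : s ∈ W := Submodule.subset_span ⟨1, one_smul G s⟩
  let : MulAction G W :=
    { smul := fun g w ↦ ⟨g • (w : V), hW g w w.2⟩
      one_smul := fun w ↦ Subtype.ext (one_smul G (w : V))
      mul_smul := fun g h w ↦ Subtype.ext (mul_smul g h (w : V)) }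
  have : Module.Finite (ZMod p) W := Module.Finite.span_of_finite _ (Set.finite_range _)
  have : Finite W := Module.finite_of_finite (ZMod p)
  have hcard : p ∣ Nat.card W := by
    have hord : addOrderOf (⟨s, hsW⟩ : W) = p :=
      addOrderOf_eq_prime (ZModModule.char_nsmul_eq_zero p _) fun h ↦ hs (congrArg Subtype.val h)
    exact hord.symm.dvd.trans (addOrderOf_dvd_natCard _)
  obtain ⟨w, hw, hne⟩ := hG.exists_fixed_point_of_prime_dvd_card_of_fixed_point W hcard
    (a := 0) fun g ↦ Subtype.ext (smul_zero g)
  exact ⟨w, fun h ↦ hne (Subtype.ext h.symm), fun g ↦ congrArg Subtype.val (hw g)⟩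

/-- Over a local ring `R`, the maximal ideal of `R` kills every simple module over an `R`-algebra
that is finite over `R`. -/
theorem IsSimpleModule.smul_eq_zero_of_mem_maximalIdeal {R A S : Type*} [CommRing R]
    [IsLocalRing R] [Ring A] [AddCommGroup S] [Module R S] [Module A S] [SMulCommClass R A S]
    [Module.Finite R S] [IsSimpleModule A S] {r : R} (hr : r ∈ IsLocalRing.maximalIdeal R)
    (s : S) : r • s = 0 := by
  have : Nontrivial S := IsSimpleModule.nontrivial A S
  rcases (DistribSMul.toLinearMap A S r).surjective_or_eq_zero with h | h
  · refine absurd ?_ (Submodule.top_ne_ideal_smul_of_le_jacobson_annihilator (M := S)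
      (IsLocalRing.maximalIdeal_le_jacobson (Module.annihilator R S)))
    refine (top_le_iff.mp fun x _ ↦ ?_).symm
    obtain ⟨y, rfl⟩ := h x
    exact Submodule.smul_mem_smul hr trivial
  · exact LinearMap.congr_fun h s

/-- An element of the group algebra acts on a vector fixed by the group through its
augmentation. -/
theorem MonoidAlgebra.smul_eq_lift_one_smul {R G S : Type*} [CommRing R] [Group G]
    [AddCommGroup S] [Module R S] [Module (MonoidAlgebra R G) S]
    [IsScalarTower R (MonoidAlgebra R G) S] {v : S}
    (hv : ∀ g : G, MonoidAlgebra.of R G g • v = v) (a : MonoidAlgebra R G) :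
    a • v = MonoidAlgebra.lift R R G 1 a • v := by
  induction a using MonoidAlgebra.induction_on with
  | of g => rw [hv, MonoidAlgebra.lift_of, MonoidHom.one_apply, one_smul]
  | add x y hx hy => rw [add_smul, hx, hy, map_add, add_smul]
  | smul r x hx => rw [smul_assoc, hx, map_smul, smul_assoc]

/-- For a finite `p`-group over a local ring of residue characteristic `p`, an element of the
group algebra whose augmentation is a unit has a left inverse. -/
theorem MonoidAlgebra.exists_mul_eq_one_of_isUnit_lift_one {p : ℕ} [Fact p.Prime] {R G : Type*}
    [CommRing R] [IsLocalRing R] [CharP (IsLocalRing.ResidueField R) p] [Group G] [Finite G]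
    (hG : IsPGroup p G) {x : MonoidAlgebra R G} (hx : IsUnit (MonoidAlgebra.lift R R G 1 x)) :
    ∃ y, y * x = 1 := by
  by_contra hinv
  have htop : Ideal.span {x} ≠ ⊤ := fun h ↦
    hinv (Ideal.mem_span_singleton'.mp ((Ideal.eq_top_iff_one _).mp h))
  obtain ⟨I, hI, hxI⟩ := Ideal.exists_le_maximal _ htop
  have : IsSimpleModule (MonoidAlgebra R G) (MonoidAlgebra R G ⧸ I) :=
    isSimpleModule_iff_isCoatom.mpr hI.out
  have : Nontrivial (MonoidAlgebra R G ⧸ I) :=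
    IsSimpleModule.nontrivial (MonoidAlgebra R G) _
  have hp : (p : R) ∈ IsLocalRing.maximalIdeal R := by
    rw [← IsLocalRing.residue_eq_zero_iff, map_natCast, CharP.cast_eq_zero]
  let : DistribMulAction G (MonoidAlgebra R G ⧸ I) :=
    DistribMulAction.compHom _ (MonoidAlgebra.of R G)
  let : Module (ZMod p) (MonoidAlgebra R G ⧸ I) := AddCommGroup.zmodModule fun s ↦ by
    rw [← Nat.cast_smul_eq_nsmul R]
    exact IsSimpleModule.smul_eq_zero_of_mem_maximalIdeal (A := MonoidAlgebra R G) hp s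
  obtain ⟨v, hv0, hv⟩ := hG.exists_ne_zero_forall_smul_eq (V := MonoidAlgebra R G ⧸ I)
  have hact := MonoidAlgebra.smul_eq_lift_one_smul (R := R) hv
  have hone : (Submodule.Quotient.mk 1 : MonoidAlgebra R G ⧸ I) ≠ 0 := fun h ↦
    hI.ne_top ((Ideal.eq_top_iff_one I).mpr ((Submodule.Quotient.mk_eq_zero I).mp h))
  obtain ⟨b, hb⟩ := IsSimpleModule.toSpanSingleton_surjective (MonoidAlgebra R G) hv0
    (Submodule.Quotient.mk 1)
  rw [LinearMap.toSpanSingleton_apply] at hb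
  have hzero : x • (Submodule.Quotient.mk 1 : MonoidAlgebra R G ⧸ I) = 0 := by
    rw [← Submodule.Quotient.mk_smul, smul_eq_mul, mul_one, Submodule.Quotient.mk_eq_zero]
    exact hxI (Ideal.mem_span_singleton_self x)
  rw [← hb, ← mul_smul, hact, map_mul, mul_smul, ← hact, hb, hx.smul_eq_zero] at hzero
  exact hone hzero

/-- If `R` is a commutative local ring whose residue field has
characteristic `p` and `Δ` is a finite `p`-group, then the group algebra `R[Δ]` is a
local ring. -/
theorem stmt_5 (p : ℕ) (hp : p.Prime) (R : Type*) [CommRing R] [IsLocalRing R]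
    [CharP (IsLocalRing.ResidueField R) p]
    (Δ : Type*) [Group Δ] [Finite Δ] (hΔ : IsPGroup p Δ) :
    IsLocalRing (MonoidAlgebra R Δ) := by
  have : Fact p.Prime := ⟨hp⟩
  let ε : MonoidAlgebra R Δ →+* R := (MonoidAlgebra.lift R R Δ 1).toRingHom
  have : IsLocalHom ε := ⟨fun x hx ↦ by
    obtain ⟨y, hyx⟩ := MonoidAlgebra.exists_mul_eq_one_of_isUnit_lift_one hΔ hx
    have hεy : IsUnit (ε y) :=
      IsUnit.of_mul_eq_one (ε x) (by rw [← map_mul, hyx, map_one])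
    obtain ⟨z, hzy⟩ := MonoidAlgebra.exists_mul_eq_one_of_isUnit_lift_one hΔ hεy
    have hxy : x * y = 1 := left_inv_eq_right_inv hzy hyx ▸ hzy
    exact ⟨⟨x, y, hxy, hyx⟩, rfl⟩⟩
  exact ε.domain_isLocalRing
end

section
/- Let N ≥ 1 be an integer and p a prime dividing N. Then the ℚ-algebra homomorphism from the group algebra ℚ[(ℤ/Npℤ)ˣ] to ℚ[(ℤ/Nℤ)ˣ], induced by the natural reduction homomorphism (ℤ/Npℤ)ˣ → (ℤ/Nℤ)ˣ of unit groups, maps the Stickelberger element θ_{Np} to the Stickelberger element θ_N. -/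
open MonoidAlgebra

/-- The Stickelberger element `θ_M = Σ_{a ∈ (ℤ/M)ˣ} (val(a)/M - 1/2)·[a]` in the group
algebra `ℚ[(ℤ/Mℤ)ˣ]`. -/
noncomputable def stickelberger (M : ℕ) [NeZero M] : MonoidAlgebra ℚ (ZMod M)ˣ :=
  ∑ a : (ZMod M)ˣ, ((((a : ZMod M).val : ℚ) / M - 1 / 2) • of ℚ (ZMod M)ˣ a)

/-- If `p` divides `N`, the units of `ℤ/Npℤ` above a unit `b` of `ℤ/Nℤ` are
represented exactly by the integers `val(b) + N * k` with `k < p`. -/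
theorem sum_units_fiber_eq_sum_range {A : Type*} [AddCommMonoid A] (N p : ℕ) [NeZero N]
    [NeZero (N * p)] (hpN : p ∣ N) (b : (ZMod N)ˣ) (g : ℕ → A) :
    ∑ a : (ZMod (N * p))ˣ with
        Units.map (ZMod.castHom (⟨p, rfl⟩ : N ∣ N * p) (ZMod N)).toMonoidHom a = b,
      g (a : ZMod (N * p)).val = ∑ k ∈ Finset.range p, g ((b : ZMod N).val + N * k) := by
  have hb : (b : ZMod N).val < N := ZMod.val_lt _
  have hN : 0 < N := NeZero.pos N
  have hcop (k : ℕ) : ((b : ZMod N).val + N * k).Coprime (N * p) := by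
    have h : ((b : ZMod N).val + N * k).Coprime N := by
      simpa using ZMod.val_coe_unit_coprime b
    exact h.mul_right (h.coprime_dvd_right hpN)
  have hval {k : ℕ} (hk : k < p) :
      ((ZMod.unitOfCoprime _ (hcop k) : (ZMod (N * p))ˣ) : ZMod (N * p)).val =
        (b : ZMod N).val + N * k := by
    rw [ZMod.coe_unitOfCoprime, ZMod.val_natCast, Nat.mod_eq_of_lt]
    nlinarith
  symm
  refine Finset.sum_bij (fun k _ ↦ ZMod.unitOfCoprime _ (hcop k)) ?_ ?_ ?_ ?_
  · intro k _
    simp only [Finset.mem_filter, Finset.mem_univ, true_and]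
    ext
    simp [-ZMod.castHom_apply]
  · intro k hk l hl h
    have h' := congrArg (fun u : (ZMod (N * p))ˣ ↦ (u : ZMod (N * p)).val) h
    simp only [hval (Finset.mem_range.1 hk), hval (Finset.mem_range.1 hl)] at h'
    exact Nat.eq_of_mul_eq_mul_left hN (by omega)
  · intro a ha
    have hmod : (a : ZMod (N * p)).val % N = (b : ZMod N).val := by
      rw [← (Finset.mem_filter.1 ha).2, ← ZMod.val_natCast]
      simp [ZMod.natCast_val]
    have hk : (a : ZMod (N * p)).val / N < p :=
      Nat.div_lt_of_lt_mul (ZMod.val_lt _)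
    refine ⟨_, Finset.mem_range.2 hk, Units.ext (ZMod.val_injective _ ?_)⟩
    rw [hval hk, ← hmod, Nat.mod_add_div]
  · intro k hk
    rw [hval (Finset.mem_range.1 hk)]

/-- The distribution relation for the first Bernoulli polynomial at `x / N`. -/
theorem sum_range_add_mul_div_sub_half (N p x : ℕ) (hN : N ≠ 0) (hp : p ≠ 0) :
    ∑ k ∈ Finset.range p, (((x + N * k : ℕ) : ℚ) / (N * p : ℕ) - 1 / 2) =
      (x : ℚ) / N - 1 / 2 := by
  have hN' : (N : ℚ) ≠ 0 := by exact_mod_cast hN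
  have hp' : (p : ℚ) ≠ 0 := by exact_mod_cast hp
  have gauss (n : ℕ) : ∑ k ∈ Finset.range n, (k : ℚ) = n * (n - 1) / 2 := by
    induction n with
    | zero => simp
    | succ n ih => rw [Finset.sum_range_succ, ih]; push_cast; ring
  push_cast
  rw [Finset.sum_sub_distrib, ← Finset.sum_div, Finset.sum_add_distrib, ← Finset.mul_sum, gauss]
  simp only [Finset.sum_const, Finset.card_range, nsmul_eq_mul]
  field_simp
  ring

/-- For `N ≥ 1` and a prime `p ∣ N`, the algebra map
`ℚ[(ℤ/Npℤ)ˣ] → ℚ[(ℤ/Nℤ)ˣ]` induced by reduction of unit groups sends the Stickelberger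
element `θ_{Np}` to `θ_N`. -/
theorem stmt_7 (N p : ℕ) (hN : 0 < N) (hp : p.Prime) (hpN : p ∣ N) :
    letI : NeZero N := ⟨hN.ne'⟩
    letI : NeZero (N * p) := ⟨(Nat.mul_pos hN hp.pos).ne'⟩
    MonoidAlgebra.mapDomainAlgHom ℚ ℚ
        (Units.map (ZMod.castHom (⟨p, rfl⟩ : N ∣ N * p) (ZMod N)).toMonoidHom)
        (stickelberger (N * p)) =
      stickelberger N := by
  have : NeZero N := ⟨hN.ne'⟩
  have : NeZero (N * p) := ⟨(Nat.mul_pos hN hp.pos).ne'⟩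
  simp only [stickelberger, map_sum, map_smul]
  rw [← Finset.sum_fiberwise Finset.univ
    (Units.map (ZMod.castHom (⟨p, rfl⟩ : N ∣ N * p) (ZMod N)).toMonoidHom)]
  refine Finset.sum_congr rfl fun b _ ↦ ?_
  rw [← sum_range_add_mul_div_sub_half N p _ hN.ne' hp.ne_zero,
    ← sum_units_fiber_eq_sum_range N p hpN b fun n ↦ (n : ℚ) / (N * p : ℕ) - 1 / 2, Finset.sum_smul]
  refine Finset.sum_congr rfl fun a ha ↦ ?_
  rw [← (Finset.mem_filter.1 ha).2]
  simp [mapDomainAlgHom]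
end
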